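/- There exists a constant c₃ > 0 depending only on the dimension d such that for every β > 0, every integer N ≥ 2, and every f ∈ L^∞(𝕋^d), one has ‖T_{N,β} f‖_{L^∞(𝕋^d)} ≤ (1 + c₃ · (1 + β N²)^{-1} · (log(N+2))^d) · ‖f‖_{L^∞(𝕋^d)}. -/

import Mathlib

open MeasureTheory

noncomputable section

/-- The fundamental domain `[0,1)^d` of the torus `𝕋^d = (ℝ/ℤ)^d`. -/
def torusBox (d : ℕ) : Set (Fin d → ℝ) :=
  Set.univ.pi fun _ => Set.Ico (0 : ℝ) 1

/-- The character `e^{2πi k·x}` on `𝕋^d`. -/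
def torusChar (d : ℕ) (k : Fin d → ℤ) (x : Fin d → ℝ) : ℂ :=
  Complex.exp (2 * Real.pi * Complex.I * (∑ i, (k i : ℝ) * x i))

/-- The truncated resolvent operator
`(T_{N,β} f)(x) = ∑_{|k|_∞ ≤ N} (1 + 4π²β|k|²)⁻¹ f̂(k) e^{2πik·x}`,
i.e. `T_{N,β} = (Id − βΔ)⁻¹ Π_N`. -/
def TNbeta (d : ℕ) (β : ℝ) (N : ℕ) (f : (Fin d → ℝ) → ℂ) (x : Fin d → ℝ) : ℂ :=
  ∑ k ∈ Fintype.piFinset (fun _ : Fin d => Finset.Icc (-(N : ℤ)) (N : ℤ)),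
    (((1 + 4 * Real.pi ^ 2 * β * ∑ i, ((k i : ℝ)) ^ 2)⁻¹ : ℝ) : ℂ) *
      (∫ y in torusBox d, f y * torusChar d (fun i => -(k i)) y) * torusChar d k x

/-- The `k`-th Fourier mode of the periodic heat kernel at time parameter `a`. -/
def gaussMode (a y : ℝ) (k : ℤ) : ℂ :=
  Complex.exp (-Real.pi * a * k ^ 2 + 2 * Real.pi * (Complex.I * y) * k)

/-- The symmetric partial sum over `|k| ≤ n` of the periodic heat kernel. -/
def gaussPartial (a : ℝ) (n : ℕ) (y : ℝ) : ℂ :=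
  ∑ k ∈ Finset.Icc (-(n : ℤ)) n, gaussMode a y k

/-- The periodic heat kernel, as a Fourier series. -/
def gaussTheta (a y : ℝ) : ℂ := ∑' k : ℤ, gaussMode a y k

/-- An integrable majorant for exponential sums of length comparable to `N`. -/
def peak (N : ℕ) (y : ℝ) : ℝ :=
  ((N : ℝ)⁻¹ + y)⁻¹ + ((N : ℝ)⁻¹ + (1 - y))⁻¹

lemma norm_one_sub_mul_sum_antitone_le {v : ℕ → ℝ} (hv : Antitone v) (h0 : ∀ k, 0 ≤ v k)
    {z : ℂ} (hz : ‖z‖ = 1) (n : ℕ) :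
    ‖(1 - z) * ∑ k ∈ Finset.range n, (v k : ℂ) * z ^ k‖ ≤ 2 * v 0 := by
  have key : ∀ n : ℕ, ‖(1 - z) * ∑ k ∈ Finset.range n, (v k : ℂ) * z ^ k + v n * z ^ n‖
      ≤ v 0 + (v 0 - v n) := by
    intro n
    induction n with
    | zero => simp [abs_of_nonneg (h0 0)]
    | succ n ih =>
      have e : (1 - z) * ∑ k ∈ Finset.range (n + 1), (v k : ℂ) * z ^ k
            + v (n + 1) * z ^ (n + 1)
          = ((1 - z) * ∑ k ∈ Finset.range n, (v k : ℂ) * z ^ k + v n * z ^ n)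
            - ((v n - v (n + 1) : ℝ) : ℂ) * z ^ (n + 1) := by
        rw [Finset.sum_range_succ]; push_cast; ring
      rw [e]
      refine (norm_sub_le _ _).trans ?_
      have hn : 0 ≤ v n - v (n + 1) := sub_nonneg.2 (hv (Nat.le_succ n))
      rw [norm_mul, norm_pow, hz, one_pow, mul_one, Complex.norm_real, Real.norm_of_nonneg hn]
      linarith
  have h1 := norm_sub_le ((1 - z) * ∑ k ∈ Finset.range n, (v k : ℂ) * z ^ k + v n * z ^ n)
    (v n * z ^ n)
  rw [add_sub_cancel_right, norm_mul (v n : ℂ), norm_pow, hz, one_pow, mul_one,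
    Complex.norm_real, Real.norm_of_nonneg (h0 n)] at h1
  linarith [key n]

lemma min_le_norm_one_sub_exp {y : ℝ} (h0 : 0 ≤ y) (h1 : y ≤ 1) :
    min y (1 - y) ≤ ‖1 - Complex.exp (2 * Real.pi * (Complex.I * y))‖ := by
  have hpi := Real.pi_pos
  have e : (2 * Real.pi * (Complex.I * y) : ℂ) = Complex.I * ((2 * Real.pi * y : ℝ) : ℂ) := by
    push_cast; ring
  rw [e, norm_sub_rev, Complex.norm_exp_I_mul_ofReal_sub_one,
    show 2 * Real.pi * y / 2 = Real.pi * y by ring, norm_mul, Real.norm_eq_abs, abs_two]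
  have hs : ∀ u : ℝ, 0 ≤ u → u ≤ 1 / 2 → u ≤ 2 * ‖Real.sin (Real.pi * u)‖ := by
    intro u hu hu'
    have := Real.mul_le_sin (x := Real.pi * u) (by positivity) (by nlinarith)
    have e2 : 2 / Real.pi * (Real.pi * u) = 2 * u := by field_simp
    have := le_abs_self (Real.sin (Real.pi * u))
    rw [Real.norm_eq_abs]
    linarith
  rcases le_total y (1 / 2) with h | h
  · exact (min_le_left _ _).trans (hs y h0 h)
  · refine (min_le_right _ _).trans ?_
    have := hs (1 - y) (by linarith) (by linarith)
    rwa [show Real.pi * (1 - y) = Real.pi - Real.pi * y by ring, Real.sin_pi_sub] at this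

lemma norm_sum_antitone_exp_le {v : ℕ → ℝ} (hv : Antitone v) (h0 : ∀ k, 0 ≤ v k) {n N : ℕ}
    (hN : 0 < N) {W : ℝ} (hW : v 0 ≤ W) (hsum : ∑ k ∈ Finset.range n, v k ≤ W * N)
    {y : ℝ} (hy0 : 0 ≤ y) (hy1 : y ≤ 1) :
    ‖∑ k ∈ Finset.range n, (v k : ℂ) * Complex.exp (2 * Real.pi * (Complex.I * y)) ^ k‖
      ≤ 3 * W * peak N y := by
  set z := Complex.exp (2 * Real.pi * (Complex.I * y)) with hz
  have hz1 : ‖z‖ = 1 := by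
    rw [hz, show (2 * Real.pi * (Complex.I * y) : ℂ) = ((2 * Real.pi * y : ℝ) : ℂ) * Complex.I by
      push_cast; ring, Complex.norm_exp_ofReal_mul_I]
  set G := ∑ k ∈ Finset.range n, (v k : ℂ) * z ^ k with hG
  have hN' : (0 : ℝ) < N := by exact_mod_cast hN
  have hW0 : 0 ≤ W := (h0 0).trans hW
  have hA : ‖G‖ ≤ W * N := by
    refine (norm_sum_le _ _).trans (le_trans (le_of_eq ?_) hsum)
    refine Finset.sum_congr rfl fun k _ => ?_
    rw [norm_mul, norm_pow, hz1, one_pow, mul_one, Complex.norm_real, Real.norm_of_nonneg (h0 k)]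
  have hB := norm_one_sub_mul_sum_antitone_le hv h0 hz1 n
  rw [← hG, norm_mul] at hB
  have hm := min_le_norm_one_sub_exp hy0 hy1
  rw [← hz] at hm
  have hC : ‖G‖ * ((N : ℝ)⁻¹ + min y (1 - y)) ≤ 3 * W := by
    have h1 : ‖G‖ * (N : ℝ)⁻¹ ≤ W := by
      rw [← div_eq_mul_inv, div_le_iff₀ hN']; exact hA
    have h2 : ‖G‖ * min y (1 - y) ≤ ‖G‖ * ‖1 - z‖ :=
      mul_le_mul_of_nonneg_left hm (norm_nonneg _)
    nlinarith
  have hNi : (0 : ℝ) < (N : ℝ)⁻¹ := by positivity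
  have hmin : 0 ≤ min y (1 - y) := le_min hy0 (by linarith)
  have hp : ((N : ℝ)⁻¹ + min y (1 - y))⁻¹ ≤ peak N y := by
    have p1 : 0 ≤ ((N : ℝ)⁻¹ + y)⁻¹ := by positivity
    have p2 : 0 ≤ ((N : ℝ)⁻¹ + (1 - y))⁻¹ := inv_nonneg.2 (by linarith)
    unfold peak
    rcases min_choice y (1 - y) with h | h <;> rw [h] <;> linarith
  calc ‖G‖ ≤ 3 * W * ((N : ℝ)⁻¹ + min y (1 - y))⁻¹ := by
        rw [← div_eq_mul_inv, le_div_iff₀ (by positivity)]; exact hC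
    _ ≤ 3 * W * peak N y := by gcongr

lemma continuousOn_peak {N : ℕ} (hN : 0 < N) : ContinuousOn (peak N) (Set.uIcc 0 1) := by
  have hNi : (0 : ℝ) < (N : ℝ)⁻¹ := by positivity
  rw [Set.uIcc_of_le zero_le_one]
  unfold peak
  refine ContinuousOn.add (ContinuousOn.inv₀ (by fun_prop) ?_) (ContinuousOn.inv₀ (by fun_prop) ?_)
  · intro x hx; linarith [hx.1]
  · intro x hx; linarith [hx.2]

lemma integral_peak {N : ℕ} (hN : 0 < N) :
    ∫ y in (0 : ℝ)..1, peak N y = 2 * Real.log (N + 1) := by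
  have hNi : (0 : ℝ) < (N : ℝ)⁻¹ := by positivity
  have hN' : (0 : ℝ) < N := by exact_mod_cast hN
  have h1 : ∫ y in (0 : ℝ)..1, ((N : ℝ)⁻¹ + y)⁻¹ = Real.log (N + 1) := by
    rw [intervalIntegral.integral_comp_add_left (fun x => x⁻¹), integral_inv]
    · congr 1; field_simp; ring
    · rw [Set.uIcc_of_le (by linarith)]; intro h; linarith [h.1]
  have h2 : ∫ y in (0 : ℝ)..1, ((N : ℝ)⁻¹ + (1 - y))⁻¹ = Real.log (N + 1) := by
    rw [intervalIntegral.integral_comp_sub_left (fun x => ((N : ℝ)⁻¹ + x)⁻¹)]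
    simpa using h1
  unfold peak
  rw [intervalIntegral.integral_add, h1, h2]
  · ring
  · refine ContinuousOn.intervalIntegrable ?_
    rw [Set.uIcc_of_le zero_le_one]
    refine ContinuousOn.inv₀ (by fun_prop) ?_
    intro x hx; linarith [hx.1]
  · refine ContinuousOn.intervalIntegrable ?_
    rw [Set.uIcc_of_le zero_le_one]
    refine ContinuousOn.inv₀ (by fun_prop) ?_
    intro x hx; linarith [hx.2]

lemma norm_gaussMode (a y : ℝ) (k : ℤ) : ‖gaussMode a y k‖ = Real.exp (-Real.pi * a * k ^ 2) := by
  rw [gaussMode, Complex.norm_exp]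
  congr 1
  rw [show (-Real.pi * a * k ^ 2 + 2 * Real.pi * (Complex.I * y) * k : ℂ)
    = ((-Real.pi * a * k ^ 2 : ℝ) : ℂ) + ((2 * Real.pi * y * k : ℝ) : ℂ) * Complex.I by
      push_cast; ring]
  rw [Complex.add_re, Complex.re_ofReal_mul, Complex.ofReal_re]; simp

lemma continuous_gaussMode (a : ℝ) (k : ℤ) : Continuous fun y => gaussMode a y k := by
  unfold gaussMode; fun_prop

lemma continuous_gaussPartial (a : ℝ) (n : ℕ) : Continuous (gaussPartial a n) :=
  continuous_finsetSum _ fun k _ => continuous_gaussMode a k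

lemma summable_exp_neg_pi_mul_sq {a : ℝ} (ha : 0 < a) :
    Summable fun k : ℤ => Real.exp (-Real.pi * a * k ^ 2) := by
  have h := (summable_jacobiTheta₂_term_iff 0 (Complex.I * a)).2 (by simpa using ha)
  refine h.norm.congr fun k => ?_
  rw [norm_jacobiTheta₂_term]
  congr 1
  simp
  ring

lemma continuous_gaussTheta {a : ℝ} (ha : 0 < a) : Continuous (gaussTheta a) :=
  continuous_tsum (continuous_gaussMode a) (summable_exp_neg_pi_mul_sq ha)
    fun k y => (norm_gaussMode a y k).le

lemma gaussTheta_eq_norm {a : ℝ} (ha : 0 < a) (y : ℝ) :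
    gaussTheta a y = (‖gaussTheta a y‖ : ℂ) := by
  have h : gaussTheta a y = ((1 / a ^ (1 / 2 : ℝ) *
      ∑' n : ℤ, Real.exp (-Real.pi / a * (n - y) ^ 2) : ℝ) : ℂ) := by
    unfold gaussTheta gaussMode
    rw [Complex.tsum_exp_neg_quadratic (by simpa using ha)]
    push_cast
    rw [Complex.ofReal_cpow ha.le]
    push_cast
    congr 1
    refine tsum_congr fun n => ?_
    congr 2
    rw [← mul_assoc, Complex.I_mul_I]
    ring
  rw [h, Complex.norm_real, Real.norm_of_nonneg]
  have : 0 ≤ ∑' n : ℤ, Real.exp (-Real.pi / a * (n - y) ^ 2) :=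
    tsum_nonneg fun n => (Real.exp_pos _).le
  positivity

lemma integral_gaussMode (a : ℝ) (k : ℤ) :
    ∫ y in (0 : ℝ)..1, gaussMode a y k = if k = 0 then 1 else 0 := by
  unfold gaussMode
  split_ifs with hk
  · simp [hk]
  · have hc : (2 * Real.pi * Complex.I * k : ℂ) ≠ 0 := by
      simp [hk, Real.pi_ne_zero]
    have e : ∀ y : ℝ, Complex.exp (-Real.pi * a * k ^ 2 + 2 * Real.pi * (Complex.I * y) * k)
        = Complex.exp (-Real.pi * a * k ^ 2) * Complex.exp ((2 * Real.pi * Complex.I * k) * y) := by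
      intro y; rw [← Complex.exp_add]; congr 1; ring
    simp_rw [e]
    rw [intervalIntegral.integral_const_mul, integral_exp_mul_complex hc]
    have : Complex.exp (2 * Real.pi * Complex.I * k) = 1 := by
      rw [mul_comm, Complex.exp_int_mul_two_pi_mul_I]
    simp [this]

lemma integral_norm_gaussTheta {a : ℝ} (ha : 0 < a) :
    ∫ y in (0 : ℝ)..1, ‖gaussTheta a y‖ = 1 := by
  have h : ∫ y in (0 : ℝ)..1, gaussTheta a y = 1 := by
    rw [intervalIntegral.integral_of_le zero_le_one]
    unfold gaussTheta
    rw [← (hasSum_integral_of_summable_integral_norm (F := fun (k : ℤ) y => gaussMode a y k)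
      (μ := volume.restrict (Set.Ioc 0 1)) ?_ ?_).tsum_eq]
    · simp_rw [← intervalIntegral.integral_of_le (zero_le_one' ℝ), integral_gaussMode]
      simp
    · exact fun k => ((continuous_gaussMode a k).intervalIntegrable 0 1).1
    · simp_rw [norm_gaussMode]
      simpa using summable_exp_neg_pi_mul_sq ha
  have h2 : ((∫ y in (0 : ℝ)..1, ‖gaussTheta a y‖ : ℝ) : ℂ) = 1 := by
    rw [← h, ← intervalIntegral.integral_ofReal]
    exact intervalIntegral.integral_congr fun y _ => (gaussTheta_eq_norm ha y).symm
  exact_mod_cast h2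

lemma sum_Icc_neg_add_sub {F : ℤ → ℂ} (m n : ℕ) :
    ∑ k ∈ Finset.Icc (-((m + n : ℕ) : ℤ)) ((m + n : ℕ) : ℤ), F k
        - ∑ k ∈ Finset.Icc (-(m : ℤ)) m, F k
      = ∑ k ∈ Finset.range n, F (m + 1 + k) + ∑ k ∈ Finset.range n, F (-(m + 1 + k)) := by
  induction n with
  | zero => simp
  | succ n ih =>
    have e : Finset.Icc (-((m + (n + 1) : ℕ) : ℤ)) ((m + (n + 1) : ℕ) : ℤ)
        = insert ((m : ℤ) + 1 + n) (insert (-((m : ℤ) + 1 + n))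
          (Finset.Icc (-((m + n : ℕ) : ℤ)) ((m + n : ℕ) : ℤ))) := by
      ext k; simp only [Finset.mem_Icc, Finset.mem_insert]; push_cast; omega
    rw [e, Finset.sum_insert, Finset.sum_insert, Finset.sum_range_succ, Finset.sum_range_succ]
    · linear_combination ih
    · simp only [Finset.mem_Icc]; push_cast; omega
    · simp only [Finset.mem_Icc, Finset.mem_insert]; push_cast; omega

lemma norm_gaussPartial_add_sub_le (a y : ℝ) (m n : ℕ) :
    ‖gaussPartial a (m + n) y - gaussPartial a m y‖
      ≤ 2 * ‖∑ k ∈ Finset.range n, ((Real.exp (-Real.pi * a * (m + 1 + k : ℝ) ^ 2) : ℝ) : ℂ)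
          * Complex.exp (2 * Real.pi * (Complex.I * y)) ^ k‖ := by
  set z := Complex.exp (2 * Real.pi * (Complex.I * y)) with hz
  have hz1 : ‖z‖ = 1 := by
    rw [hz, show (2 * Real.pi * (Complex.I * y) : ℂ) = ((2 * Real.pi * y : ℝ) : ℂ) * Complex.I by
      push_cast; ring, Complex.norm_exp_ofReal_mul_I]
  set G := ∑ k ∈ Finset.range n, ((Real.exp (-Real.pi * a * (m + 1 + k : ℝ) ^ 2) : ℝ) : ℂ) * z ^ k
    with hG
  have h1 : ∑ k ∈ Finset.range n, gaussMode a y (m + 1 + k) = z ^ (m + 1) * G := by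
    rw [hG, Finset.mul_sum]
    refine Finset.sum_congr rfl fun k _ => ?_
    rw [mul_left_comm, ← pow_add, gaussMode, hz, ← Complex.exp_nat_mul, Complex.ofReal_exp,
      ← Complex.exp_add]
    congr 1; push_cast; ring
  have h2 : ∑ k ∈ Finset.range n, gaussMode a y (-(m + 1 + k))
      = (starRingEnd ℂ) (∑ k ∈ Finset.range n, gaussMode a y (m + 1 + k)) := by
    rw [map_sum]
    refine Finset.sum_congr rfl fun k _ => ?_
    rw [gaussMode, gaussMode, ← Complex.exp_conj]
    congr 1; simp [Complex.conj_ofNat]; ring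
  unfold gaussPartial
  rw [sum_Icc_neg_add_sub]
  refine (norm_add_le _ _).trans ?_
  rw [h2, Complex.norm_conj, h1, norm_mul, norm_pow, hz1, one_pow]
  linarith

lemma antitone_exp_neg_sq {a : ℝ} (ha : 0 < a) (m : ℕ) :
    Antitone fun k : ℕ => Real.exp (-Real.pi * a * (m + 1 + k : ℝ) ^ 2) := by
  intro i j hij
  have hij' : (i : ℝ) ≤ j := by exact_mod_cast hij
  have hpa : 0 < Real.pi * a := mul_pos Real.pi_pos ha
  have : (m + 1 + i : ℝ) ^ 2 ≤ (m + 1 + j : ℝ) ^ 2 := by gcongr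
  refine Real.exp_le_exp.2 ?_
  nlinarith

lemma sum_exp_neg_sq_tail_le {a : ℝ} {N : ℕ} (hN : 0 < N) (h : 1 ≤ Real.pi * a * N ^ 2) (n : ℕ) :
    ∑ k ∈ Finset.range n, Real.exp (-Real.pi * a * (N + 1 + k : ℝ) ^ 2)
      ≤ Real.exp (-Real.pi * a * N ^ 2) * N := by
  have hN' : (0 : ℝ) < N := by exact_mod_cast hN
  set q := Real.exp (-(2 / N : ℝ)) with hq
  have hq0 : 0 < q := Real.exp_pos _
  have hpa : 1 / N ≤ Real.pi * a * N := by
    rw [div_le_iff₀ hN']; nlinarith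
  have hpa0 : 0 ≤ Real.pi * a := by
    by_contra hc
    push Not at hc
    nlinarith [sq_nonneg (N : ℝ)]
  have hqN : q * (2 / N + 1) ≤ 1 := by
    have := Real.add_one_le_exp (2 / N : ℝ)
    calc q * (2 / N + 1) ≤ q * Real.exp (2 / N) := by gcongr
      _ = 1 := by rw [hq, ← Real.exp_add]; simp
  have hqN' : q ≤ N * (1 - q) := by
    have e : q * (2 / N + 1) * N = 2 * q + q * N := by field_simp
    nlinarith
  have hterm : ∀ k : ℕ, Real.exp (-Real.pi * a * (N + 1 + k : ℝ) ^ 2)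
      ≤ Real.exp (-Real.pi * a * N ^ 2) * q * q ^ k := by
    intro k
    rw [mul_assoc (Real.exp _), ← pow_succ', hq, ← Real.exp_nat_mul, ← Real.exp_add]
    refine Real.exp_le_exp.2 ?_
    have h3 : (0 : ℝ) ≤ 1 + k := by positivity
    have h4 : (1 + k : ℝ) * (1 / N) ≤ (1 + k) * (Real.pi * a * N) := by gcongr
    have h5 : 0 ≤ Real.pi * a * (1 + k : ℝ) ^ 2 := by positivity
    push_cast
    have e : (k + 1 : ℝ) * (-(2 / N)) = - (2 * ((1 + k) * (1 / N))) := by ring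
    rw [e]
    nlinarith
  have hgeom : (1 - q) * ∑ k ∈ Finset.range n, q ^ k ≤ 1 := by
    rw [mul_comm, geom_sum_mul_neg]
    have := pow_pos hq0 n
    linarith
  have hs : 0 ≤ ∑ k ∈ Finset.range n, q ^ k := Finset.sum_nonneg fun k _ => (pow_pos hq0 k).le
  calc _ ≤ ∑ k ∈ Finset.range n, Real.exp (-Real.pi * a * N ^ 2) * q * q ^ k :=
        Finset.sum_le_sum fun k _ => hterm k
    _ = Real.exp (-Real.pi * a * N ^ 2) * (q * ∑ k ∈ Finset.range n, q ^ k) := by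
        rw [← Finset.mul_sum]; ring
    _ ≤ Real.exp (-Real.pi * a * N ^ 2) * N := by
        gcongr
        calc q * ∑ k ∈ Finset.range n, q ^ k ≤ N * (1 - q) * ∑ k ∈ Finset.range n, q ^ k := by
              gcongr
          _ = N * ((1 - q) * ∑ k ∈ Finset.range n, q ^ k) := by ring
          _ ≤ N * 1 := by gcongr
          _ = N := mul_one _

lemma tendsto_gaussPartial {a : ℝ} (ha : 0 < a) (y : ℝ) (N : ℕ) :
    Filter.Tendsto (fun n => gaussPartial a (N + n) y) Filter.atTop (nhds (gaussTheta a y)) := by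
  have hs : Summable (gaussMode a y) :=
    Summable.of_norm ((summable_exp_neg_pi_mul_sq ha).congr fun k => (norm_gaussMode a y k).symm)
  have h : Filter.Tendsto (fun n => gaussPartial a n y) Filter.atTop (nhds (gaussTheta a y)) :=
    hs.hasSum.comp (Finset.tendsto_Icc_neg (R := ℤ))
  exact h.comp (Filter.tendsto_atTop_mono (fun n => Nat.le_add_left n N) Filter.tendsto_id)

/-- The `L¹` norm of the truncated periodic heat kernel exceeds one by at most a
logarithm damped by the last Fourier coefficient. -/
lemma integral_norm_gaussPartial_le {a : ℝ} (ha : 0 < a) {N : ℕ} (hN : 0 < N) :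
    ∫ y in (0 : ℝ)..1, ‖gaussPartial a N y‖
      ≤ 1 + 36 * Real.exp (-Real.pi * a * N ^ 2) * Real.log (N + 2) := by
  have hN' : (0 : ℝ) < N := by exact_mod_cast hN
  have hpi := Real.pi_pos
  have hl1 : 0 ≤ Real.log (N + 1) := Real.log_nonneg (by linarith)
  have hl : Real.log (N + 1) ≤ Real.log (N + 2) := Real.log_le_log (by positivity) (by linarith)
  have hpk : IntervalIntegrable (peak N) volume 0 1 := (continuousOn_peak hN).intervalIntegrable
  have hS : IntervalIntegrable (fun y => ‖gaussPartial a N y‖) volume 0 1 :=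
    (continuous_gaussPartial a N).norm.intervalIntegrable _ _
  set W := Real.exp (-Real.pi * a * N ^ 2) with hW
  have hW0 : 0 < W := Real.exp_pos _
  rcases le_total 1 (Real.pi * a * N ^ 2) with h | h
  · have hpt : ∀ y ∈ Set.Icc (0 : ℝ) 1,
        ‖gaussPartial a N y‖ ≤ ‖gaussTheta a y‖ + 6 * W * peak N y := by
      intro y hy
      have hd : ‖gaussTheta a y - gaussPartial a N y‖ ≤ 6 * W * peak N y := by
        refine le_of_tendsto ((tendsto_gaussPartial ha y N).sub_const _).norm
          (Filter.Eventually.of_forall fun n => ?_)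
        refine (norm_gaussPartial_add_sub_le a y N n).trans ?_
        have := norm_sum_antitone_exp_le (antitone_exp_neg_sq ha N) (fun k => (Real.exp_pos _).le)
          (n := n) hN (W := W) ?_ (sum_exp_neg_sq_tail_le hN h n) hy.1 hy.2
        · linarith
        · refine Real.exp_le_exp.2 ?_
          have : 0 < Real.pi * a := by positivity
          push_cast
          nlinarith
      have := norm_sub_norm_le (gaussPartial a N y) (gaussTheta a y)
      rw [norm_sub_rev] at this
      linarith
    have hth : IntervalIntegrable (fun y => ‖gaussTheta a y‖) volume 0 1 :=
      (continuous_gaussTheta ha).norm.intervalIntegrable _ _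
    refine (intervalIntegral.integral_mono_on zero_le_one hS
      (hth.add (hpk.const_mul (6 * W))) hpt).trans ?_
    rw [intervalIntegral.integral_add hth (hpk.const_mul (6 * W)), integral_norm_gaussTheta ha,
      intervalIntegral.integral_const_mul, integral_peak hN]
    nlinarith [mul_le_mul_of_nonneg_left hl hW0.le, mul_nonneg hW0.le hl1]
  · have hW3 : 1 ≤ 3 * W := by
      have h1 : Real.exp (-1) ≤ W := Real.exp_le_exp.2 (by linarith)
      have h2 : Real.exp (-1) * Real.exp 1 = 1 := by rw [← Real.exp_add]; simp
      nlinarith [Real.exp_one_lt_d9, Real.exp_pos (-1)]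
    have hpt : ∀ y ∈ Set.Icc (0 : ℝ) 1, ‖gaussPartial a N y‖ ≤ 1 + 6 * peak N y := by
      intro y hy
      have h1 := norm_gaussPartial_add_sub_le a y 0 N
      have hle : ∀ k : ℕ, Real.exp (-Real.pi * a * ((0 : ℕ) + 1 + k : ℝ) ^ 2) ≤ 1 := by
        intro k
        refine Real.exp_le_one_iff.2 ?_
        have : 0 ≤ Real.pi * a * ((0 : ℕ) + 1 + k : ℝ) ^ 2 := by positivity
        linarith
      have h2 := norm_sum_antitone_exp_le (antitone_exp_neg_sq ha 0) (fun k => (Real.exp_pos _).le)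
          (n := N) hN (W := 1) (hle 0)
          (by simpa using Finset.sum_le_sum fun k (_ : k ∈ Finset.range N) => hle k) hy.1 hy.2
      have h0 : gaussPartial a 0 y = 1 := by simp [gaussPartial, gaussMode]
      rw [zero_add, h0] at h1
      have := norm_sub_norm_le (gaussPartial a N y) 1
      rw [norm_one] at this
      linarith
    refine (intervalIntegral.integral_mono_on zero_le_one hS
      (intervalIntegrable_const.add (hpk.const_mul 6)) hpt).trans ?_
    rw [intervalIntegral.integral_add intervalIntegrable_const (hpk.const_mul 6),
      intervalIntegral.integral_const_mul, integral_peak hN]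
    simp only [intervalIntegral.integral_const, smul_eq_mul]
    nlinarith [mul_le_mul_of_nonneg_right hW3 (hl1.trans hl)]

lemma gaussMode_add_one (a y : ℝ) (k : ℤ) : gaussMode a (y + 1) k = gaussMode a y k := by
  unfold gaussMode
  rw [Complex.exp_eq_exp_iff_exists_int]
  exact ⟨k, by push_cast; ring⟩

lemma periodic_norm_gaussPartial (a : ℝ) (N : ℕ) :
    Function.Periodic (fun y => ‖gaussPartial a N y‖) 1 := by
  intro y
  simp only [gaussPartial, gaussMode_add_one]

lemma setIntegral_norm_gaussPartial_sub (a : ℝ) (N : ℕ) (x : ℝ) :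
    ∫ y in Set.Ico (0 : ℝ) 1, ‖gaussPartial a N (x - y)‖
      = ∫ y in (0 : ℝ)..1, ‖gaussPartial a N y‖ := by
  rw [integral_Ico_eq_integral_Ioc, ← intervalIntegral.integral_of_le zero_le_one,
    intervalIntegral.integral_comp_sub_left (fun y => ‖gaussPartial a N y‖)]
  have := (periodic_norm_gaussPartial a N).intervalIntegral_add_eq (x - 1) 0
  simpa using this

lemma volume_restrict_torusBox (d : ℕ) :
    (volume : Measure (Fin d → ℝ)).restrict (torusBox d)
      = Measure.pi fun _ => volume.restrict (Set.Ico (0 : ℝ) 1) :=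
  Measure.restrict_pi_pi (fun _ => volume) fun _ => Set.Ico (0 : ℝ) 1

instance isProbabilityMeasure_torusBox (d : ℕ) :
    IsProbabilityMeasure ((volume : Measure (Fin d → ℝ)).restrict (torusBox d)) := by
  rw [volume_restrict_torusBox]
  have : IsProbabilityMeasure ((volume : Measure ℝ).restrict (Set.Ico (0 : ℝ) 1)) :=
    ⟨by simp⟩
  infer_instance

lemma norm_torusChar (d : ℕ) (k : Fin d → ℤ) (x : Fin d → ℝ) : ‖torusChar d k x‖ = 1 := by
  unfold torusChar
  rw [← Complex.norm_exp_ofReal_mul_I (2 * Real.pi * ∑ i, (k i : ℝ) * x i)]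
  congr 2; push_cast; ring

lemma continuous_torusChar (d : ℕ) (k : Fin d → ℤ) : Continuous (torusChar d k) := by
  unfold torusChar; fun_prop

lemma prod_gaussMode_sub {d : ℕ} (a : ℝ) (x y : Fin d → ℝ) (k : Fin d → ℤ) :
    ∏ i, gaussMode a (x i - y i) (k i)
      = ((Real.exp (-Real.pi * a * ∑ i, (k i : ℝ) ^ 2) : ℝ) : ℂ)
        * torusChar d (fun i => -(k i)) y * torusChar d k x := by
  unfold gaussMode torusChar
  rw [← Complex.exp_sum, Complex.ofReal_exp, ← Complex.exp_add, ← Complex.exp_add]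
  congr 1
  push_cast
  simp only [Finset.mul_sum, ← Finset.sum_add_distrib]
  refine Finset.sum_congr rfl fun i _ => ?_
  ring

lemma prod_gaussPartial_sub {d : ℕ} (a : ℝ) (N : ℕ) (x y : Fin d → ℝ) :
    ∏ i, gaussPartial a N (x i - y i)
      = ∑ k ∈ Fintype.piFinset (fun _ : Fin d => Finset.Icc (-(N : ℤ)) (N : ℤ)),
        ((Real.exp (-Real.pi * a * ∑ i, (k i : ℝ) ^ 2) : ℝ) : ℂ)
          * torusChar d (fun i => -(k i)) y * torusChar d k x := by
  simp only [gaussPartial]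
  rw [Finset.prod_univ_sum]
  exact Finset.sum_congr rfl fun k _ => prod_gaussMode_sub a x y k

/-- The truncated heat semigroup on the torus, applied to `f`. -/
def truncHeat (d : ℕ) (a : ℝ) (N : ℕ) (f : (Fin d → ℝ) → ℂ) (x : Fin d → ℝ) : ℂ :=
  ∑ k ∈ Fintype.piFinset (fun _ : Fin d => Finset.Icc (-(N : ℤ)) (N : ℤ)),
    ((Real.exp (-Real.pi * a * ∑ i, (k i : ℝ) ^ 2) : ℝ) : ℂ) *
      (∫ y in torusBox d, f y * torusChar d (fun i => -(k i)) y) * torusChar d k x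

lemma truncHeat_eq_integral {d : ℕ} (a : ℝ) (N : ℕ) {f : (Fin d → ℝ) → ℂ} (hf : Measurable f)
    {M : ℝ} (hM : ∀ᵐ x ∂(volume.restrict (torusBox d)), ‖f x‖ ≤ M) (x : Fin d → ℝ) :
    truncHeat d a N f x = ∫ y in torusBox d, f y * ∏ i, gaussPartial a N (x i - y i) := by
  have hint : ∀ k : Fin d → ℤ,
      Integrable (fun y => f y * torusChar d k y) (volume.restrict (torusBox d)) := fun k =>
    Integrable.of_bound (hf.mul (continuous_torusChar d k).measurable).aestronglyMeasurable M
      (hM.mono fun y hy => by rwa [norm_mul, norm_torusChar, mul_one])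
  have e : ∀ y, f y * ∏ i, gaussPartial a N (x i - y i)
      = ∑ k ∈ Fintype.piFinset (fun _ : Fin d => Finset.Icc (-(N : ℤ)) (N : ℤ)),
        ((Real.exp (-Real.pi * a * ∑ i, (k i : ℝ) ^ 2) : ℝ) : ℂ)
          * (f y * torusChar d (fun i => -(k i)) y) * torusChar d k x := by
    intro y
    rw [prod_gaussPartial_sub, Finset.mul_sum]
    exact Finset.sum_congr rfl fun k _ => by ring
  simp_rw [e]
  rw [integral_finsetSum _ fun k _ => ((hint _).const_mul _).mul_const _]
  refine Finset.sum_congr rfl fun k _ => ?_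
  rw [integral_mul_const, integral_const_mul]

lemma norm_truncHeat_le {d : ℕ} {a : ℝ} (ha : 0 < a) {N : ℕ} (hN : 0 < N)
    {f : (Fin d → ℝ) → ℂ} (hf : Measurable f) {M : ℝ} (hM0 : 0 ≤ M)
    (hM : ∀ᵐ x ∂(volume.restrict (torusBox d)), ‖f x‖ ≤ M) (x : Fin d → ℝ) :
    ‖truncHeat d a N f x‖
      ≤ M * (1 + 36 * Real.exp (-Real.pi * a * N ^ 2) * Real.log (N + 2)) ^ d := by
  rw [truncHeat_eq_integral a N hf hM x]
  have hi : Integrable (fun y : Fin d → ℝ => ∏ i, ‖gaussPartial a N (x i - y i)‖)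
      (volume.restrict (torusBox d)) := by
    rw [volume_restrict_torusBox]
    refine Integrable.fintype_prod (f := fun i y => ‖gaussPartial a N (x i - y)‖) fun i => ?_
    have hc : Continuous fun y => ‖gaussPartial a N (x i - y)‖ :=
      ((continuous_gaussPartial a N).comp (continuous_const.sub continuous_id)).norm
    exact (hc.integrableOn_Icc (a := 0) (b := 1)).mono_set Set.Ico_subset_Icc_self
  refine (norm_integral_le_of_norm_le (hi.const_mul M) (hM.mono fun y hy => ?_)).trans ?_
  · rw [norm_mul, norm_prod]
    exact mul_le_mul_of_nonneg_right hy (Finset.prod_nonneg fun _ _ => norm_nonneg _)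
  · rw [integral_const_mul, volume_restrict_torusBox,
      integral_fintype_prod_eq_prod (fun i y => ‖gaussPartial a N (x i - y)‖)]
    simp_rw [setIntegral_norm_gaussPartial_sub]
    rw [Finset.prod_const, Finset.card_univ, Fintype.card_fin]
    have h0 : 0 ≤ ∫ y in (0 : ℝ)..1, ‖gaussPartial a N y‖ :=
      intervalIntegral.integral_nonneg zero_le_one fun _ _ => norm_nonneg _
    gcongr
    exact integral_norm_gaussPartial_le ha hN

lemma one_add_mul_pow_le {C q L : ℝ} (hC : 0 ≤ C) (hq0 : 0 ≤ q) (hq1 : q ≤ 1) (hL : 1 ≤ L)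
    (d : ℕ) : (1 + C * q * L) ^ d ≤ 1 + q * ((1 + 2 * C) * L) ^ d := by
  induction d with
  | zero => simpa using hq0
  | succ d ih =>
    set X := ((1 + 2 * C) * L) ^ d with hX
    have hX1 : 1 ≤ X := one_le_pow₀ (by nlinarith)
    have h1 : q * (C * L * X) ≤ C * L * X :=
      mul_le_of_le_one_left (by positivity) hq1
    have h2 : C * L * 1 ≤ C * L * X := by gcongr
    have h3 : X * 1 ≤ X * L := by gcongr
    calc (1 + C * q * L) ^ (d + 1) = (1 + C * q * L) ^ d * (1 + C * q * L) := pow_succ _ _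
      _ ≤ (1 + q * X) * (1 + C * q * L) := by gcongr
      _ = 1 + q * (X + C * L + q * (C * L * X)) := by ring
      _ ≤ 1 + q * (X * L + C * L * X + C * L * X) := by
        refine add_le_add_right (mul_le_mul_of_nonneg_left ?_ hq0) 1
        linarith
      _ = 1 + q * ((1 + 2 * C) * L) ^ (d + 1) := by rw [pow_succ, ← hX]; ring

lemma integrableOn_exp_neg_mul {b : ℝ} (hb : 0 < b) :
    IntegrableOn (fun t => Real.exp (-b * t)) (Set.Ioi 0) :=
  integrableOn_exp_mul_Ioi (neg_neg_of_pos hb) 0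

lemma integral_exp_neg_mul_Ioi_zero {b : ℝ} (hb : 0 < b) :
    ∫ t in Set.Ioi (0 : ℝ), Real.exp (-b * t) = b⁻¹ := by
  rw [integral_exp_mul_Ioi (neg_neg_of_pos hb)]
  simp [neg_div_neg_eq]

/-- The truncated resolvent is the Laplace transform of the truncated heat semigroup. -/
lemma TNbeta_eq_integral_truncHeat {d : ℕ} {β : ℝ} (hβ : 0 < β) (N : ℕ)
    (f : (Fin d → ℝ) → ℂ) (x : Fin d → ℝ) :
    TNbeta d β N f x = ∫ t in Set.Ioi (0 : ℝ),
      ((Real.exp (-t) : ℝ) : ℂ) * truncHeat d (4 * Real.pi * β * t) N f x := by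
  have hb : ∀ k : Fin d → ℤ, 0 < 1 + 4 * Real.pi ^ 2 * β * ∑ i, (k i : ℝ) ^ 2 := fun k => by
    have : 0 ≤ ∑ i, (k i : ℝ) ^ 2 := Finset.sum_nonneg fun i _ => sq_nonneg _
    positivity
  have e : ∀ t : ℝ, ((Real.exp (-t) : ℝ) : ℂ) * truncHeat d (4 * Real.pi * β * t) N f x
      = ∑ k ∈ Fintype.piFinset (fun _ : Fin d => Finset.Icc (-(N : ℤ)) (N : ℤ)),
        ((Real.exp (-(1 + 4 * Real.pi ^ 2 * β * ∑ i, (k i : ℝ) ^ 2) * t) : ℝ) : ℂ) *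
        (∫ y in torusBox d, f y * torusChar d (fun i => -(k i)) y) * torusChar d k x := by
    intro t
    rw [truncHeat, Finset.mul_sum]
    refine Finset.sum_congr rfl fun k _ => ?_
    rw [← mul_assoc, ← mul_assoc, ← Complex.ofReal_mul, ← Real.exp_add]
    congr 5
    ring
  simp_rw [e]
  rw [integral_finsetSum _ fun k _ =>
    (((integrableOn_exp_neg_mul (hb k)).ofReal).mul_const _).mul_const _]
  refine Finset.sum_congr rfl fun k _ => ?_
  rw [integral_mul_const, integral_mul_const, integral_complex_ofReal,
    integral_exp_neg_mul_Ioi_zero (hb k)]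

/-- There exists `c₃ > 0` depending only on `d` such that for every `β > 0`,
every integer `N ≥ 2` and every `f ∈ L^∞(𝕋^d)`,
`‖T_{N,β} f‖_∞ ≤ (1 + c₃ (1 + βN²)⁻¹ (log (N+2))^d) ‖f‖_∞`. -/
theorem statement1 (d : ℕ) (hd : 1 ≤ d) :
    ∃ c₃ : ℝ, 0 < c₃ ∧
      ∀ β : ℝ, 0 < β → ∀ N : ℕ, 2 ≤ N →
        ∀ f : (Fin d → ℝ) → ℂ, Measurable f →
          (∀ (m : Fin d → ℤ) (x : Fin d → ℝ), f (fun i => x i + (m i : ℝ)) = f x) →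
          ∀ M : ℝ, (∀ᵐ x ∂(volume.restrict (torusBox d)), ‖f x‖ ≤ M) →
            ∀ x : Fin d → ℝ,
              ‖TNbeta d β N f x‖
                ≤ (1 + c₃ * (1 + β * (N : ℝ) ^ 2)⁻¹ * Real.log ((N : ℝ) + 2) ^ d) * M := by
  refine ⟨73 ^ d, by positivity, ?_⟩
  intro β hβ N hN f hf _ M hM x
  have hM0 : 0 ≤ M := by
    obtain ⟨y, hy⟩ := hM.exists
    exact (norm_nonneg _).trans hy
  have hpi := Real.pi_gt_three
  set L := Real.log ((N : ℝ) + 2) with hL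
  have hL1 : 1 ≤ L := by
    rw [hL, Real.le_log_iff_exp_le (by positivity)]
    have : (2 : ℝ) ≤ N := by exact_mod_cast hN
    linarith [Real.exp_one_lt_d9]
  set b := 1 + 4 * Real.pi ^ 2 * β * (N : ℝ) ^ 2 with hb
  have hb0 : 0 < b := by positivity
  have hpt : ∀ t ∈ Set.Ioi (0 : ℝ),
      ‖((Real.exp (-t) : ℝ) : ℂ) * truncHeat d (4 * Real.pi * β * t) N f x‖
        ≤ M * Real.exp (-1 * t) + M * (73 * L) ^ d * Real.exp (-b * t) := by
    intro t ht
    have ht : 0 < t := ht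
    have h1 := norm_truncHeat_le (a := 4 * Real.pi * β * t) (by positivity)
      (by omega : 0 < N) hf hM0 hM x
    set q := Real.exp (-Real.pi * (4 * Real.pi * β * t) * N ^ 2) with hq
    have hq1 : q ≤ 1 := by
      refine Real.exp_le_one_iff.2 ?_
      have : 0 ≤ Real.pi * (4 * Real.pi * β * t) * N ^ 2 := by positivity
      linarith
    have h2 : (1 + 36 * q * L) ^ d ≤ 1 + q * (73 * L) ^ d := by
      have := one_add_mul_pow_le (C := 36) (by norm_num) (Real.exp_pos _).le hq1 hL1 d
      rwa [show (1 + 2 * 36 : ℝ) = 73 by norm_num] at this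
    have hqt : Real.exp (-b * t) = Real.exp (-t) * q := by
      rw [hq, ← Real.exp_add, hb]; congr 1; ring
    rw [norm_mul, Complex.norm_real, Real.norm_of_nonneg (Real.exp_pos _).le, hqt, neg_one_mul]
    calc Real.exp (-t) * ‖truncHeat d (4 * Real.pi * β * t) N f x‖
        ≤ Real.exp (-t) * (M * (1 + q * (73 * L) ^ d)) := by
          gcongr
          exact h1.trans (by gcongr)
      _ = _ := by ring
  have hi1 : IntegrableOn (fun t => M * Real.exp (-1 * t)) (Set.Ioi 0) :=
    (integrableOn_exp_neg_mul one_pos).const_mul _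
  have hi2 : IntegrableOn (fun t => M * (73 * L) ^ d * Real.exp (-b * t)) (Set.Ioi 0) :=
    (integrableOn_exp_neg_mul hb0).const_mul _
  have hbi : b⁻¹ ≤ (1 + β * (N : ℝ) ^ 2)⁻¹ := by
    refine inv_anti₀ (by positivity) ?_
    have : 0 ≤ β * (N : ℝ) ^ 2 := by positivity
    have : 1 ≤ 4 * Real.pi ^ 2 := by nlinarith
    rw [hb]
    nlinarith
  rw [TNbeta_eq_integral_truncHeat hβ]
  refine (norm_integral_le_of_norm_le (hi1.add hi2)
    ((ae_restrict_iff' measurableSet_Ioi).2 (Filter.Eventually.of_forall hpt))).trans ?_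
  simp only [Pi.add_apply]
  rw [integral_add hi1 hi2, integral_const_mul, integral_const_mul,
    integral_exp_neg_mul_Ioi_zero one_pos, integral_exp_neg_mul_Ioi_zero hb0, inv_one]
  calc M * 1 + M * (73 * L) ^ d * b⁻¹
      ≤ M * 1 + M * (73 * L) ^ d * (1 + β * (N : ℝ) ^ 2)⁻¹ := by gcongr
    _ = _ := by rw [mul_pow]; ring

end
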